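/- Let f(z) = ∑_{n=1}^∞ (a_n/√n) W_{iR}(2πny) sin(2πnx) satisfy f(z) = w f(−1/(Nz)) with w = ±1, assuming term-by-term differentiation in x is valid. Then for all y > 0: ∑_{n=1}^∞ a_n √n ( W_{iR}(2πny) + (w/(Ny²)) W_{iR}(2πn/(Ny)) ) = 0. In particular, if w = 1 and y = 1/√N, then ∑_{n=1}^∞ a_n √n W_{iR}(2πn/√N) = 0. -/

import Mathlib

open Real Complex

/-- `W_{iR}(y) = √y K_{iR}(y)`, with `K_{iR}` given by its standard integral
representation `K_{iR}(y) = ∫₀^∞ e^{-y cosh t} cos (R t) dt`. -/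
noncomputable def WiR (R y : ℝ) : ℝ :=
  Real.sqrt y * ∫ t in Set.Ioi (0:ℝ), Real.exp (-y * Real.cosh t) * Real.cos (R * t)

theorem half_sq_le_cosh_sub_one (t : ℝ) : t ^ 2 / 2 ≤ Real.cosh t - 1 := by
  have h := Real.cosh_sq (t / 2)
  have h2 : Real.cosh t = 2 * Real.sinh (t / 2) ^ 2 + 1 := by
    have := Real.cosh_two_mul (t / 2)
    rw [show 2 * (t / 2) = t by ring] at this
    linarith
  have h3 : (t / 2) ^ 2 ≤ Real.sinh (t / 2) ^ 2 := by
    rw [sq_le_sq]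
    rcases le_total 0 (t / 2) with h0 | h0
    · rw [abs_of_nonneg h0, abs_of_nonneg (Real.sinh_nonneg_iff.2 h0)]
      exact Real.self_le_sinh_iff.2 h0
    · rw [abs_of_nonpos h0, abs_of_nonpos (Real.sinh_nonpos_iff.2 h0)]
      exact neg_le_neg (Real.sinh_le_self_iff.2 h0)
  nlinarith

theorem exp_neg_mul_cosh_le {y : ℝ} (hy : 0 < y) (t : ℝ) :
    Real.exp (-y * Real.cosh t) ≤ Real.exp (-y) * Real.exp (-(y / 2) * t ^ 2) := by
  rw [← Real.exp_add]
  apply Real.exp_le_exp.2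
  nlinarith [half_sq_le_cosh_sub_one t]

theorem integrable_exp_neg_mul_cosh {y : ℝ} (hy : 0 < y) :
    MeasureTheory.Integrable (fun t : ℝ => Real.exp (-y * Real.cosh t)) := by
  refine ((integrable_exp_neg_mul_sq (half_pos hy)).const_mul (Real.exp (-y))).mono'
    (by fun_prop) (Filter.Eventually.of_forall fun t => ?_)
  rw [Real.norm_eq_abs, abs_of_pos (Real.exp_pos _)]
  exact exp_neg_mul_cosh_le hy t

theorem integrable_exp_neg_mul_cosh_mul_cos (R : ℝ) {y : ℝ} (hy : 0 < y) :
    MeasureTheory.Integrable (fun t : ℝ => Real.exp (-y * Real.cosh t) * Real.cos (R * t)) := by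
  refine (integrable_exp_neg_mul_cosh hy).mono' (by fun_prop)
    (Filter.Eventually.of_forall fun t => ?_)
  rw [norm_mul, Real.norm_eq_abs, abs_of_pos (Real.exp_pos _)]
  exact mul_le_of_le_one_right (Real.exp_pos _).le (Real.abs_cos_le_one _)

theorem abs_WiR_le (R : ℝ) {y : ℝ} (hy : 0 < y) :
    |WiR R y| ≤ Real.sqrt (π * 2) / 2 * Real.exp (-y) := by
  have h : ‖∫ t in Set.Ioi (0:ℝ), Real.exp (-y * Real.cosh t) * Real.cos (R * t)‖ ≤
      ∫ t in Set.Ioi (0:ℝ), Real.exp (-y) * Real.exp (-(y / 2) * t ^ 2) := by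
    refine MeasureTheory.norm_integral_le_of_norm_le
      ((integrable_exp_neg_mul_sq (half_pos hy)).const_mul (Real.exp (-y))).integrableOn
      (Filter.Eventually.of_forall fun t => ?_)
    rw [norm_mul, Real.norm_eq_abs, abs_of_pos (Real.exp_pos _)]
    exact (mul_le_of_le_one_right (Real.exp_pos _).le (Real.abs_cos_le_one _)).trans
      (exp_neg_mul_cosh_le hy t)
  rw [MeasureTheory.integral_const_mul, integral_gaussian_Ioi] at h
  rw [WiR, abs_mul, abs_of_nonneg (Real.sqrt_nonneg y)]
  calc _ ≤ _ := mul_le_mul_of_nonneg_left h (Real.sqrt_nonneg y)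
    _ = (Real.sqrt y * Real.sqrt (π / (y / 2))) / 2 * Real.exp (-y) := by ring
    _ = _ := by
      rw [← Real.sqrt_mul hy.le]
      congr 3
      field_simp

theorem continuousAt_WiR (R : ℝ) {y : ℝ} (hy : 0 < y) : ContinuousAt (WiR R) y := by
  unfold WiR
  refine Real.continuous_sqrt.continuousAt.mul ?_
  refine MeasureTheory.continuousAt_of_dominated
    (bound := fun t => Real.exp (-(y / 2) * Real.cosh t))
    (Filter.Eventually.of_forall fun s => by fun_prop) ?_
    (integrable_exp_neg_mul_cosh (half_pos hy)).integrableOn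
    (Filter.Eventually.of_forall fun t => by fun_prop)
  filter_upwards [lt_mem_nhds (half_lt_self hy)] with s hs
  refine Filter.Eventually.of_forall fun t => ?_
  rw [norm_mul, Real.norm_eq_abs, abs_of_pos (Real.exp_pos _)]
  refine (mul_le_of_le_one_right (Real.exp_pos _).le (Real.abs_cos_le_one _)).trans ?_
  apply Real.exp_le_exp.2
  nlinarith [Real.cosh_pos t]

theorem cosh_sub_one_le_sq {t : ℝ} (ht : |t| ≤ 1) : Real.cosh t - 1 ≤ t ^ 2 := by
  have h := Real.cosh_le_exp_half_sq t
  have h1 : t ^ 2 ≤ 1 := (sq_le_one_iff_abs_le_one t).2 ht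
  have h2 := Real.abs_exp_sub_one_le (x := t ^ 2 / 2) (by rw [abs_of_nonneg (by positivity)]; linarith)
  rw [abs_of_nonneg (by positivity : 0 ≤ t ^ 2 / 2)] at h2
  linarith [le_abs_self (Real.exp (t ^ 2 / 2) - 1)]

theorem exp_neg_le_integral {y : ℝ} (hy : 1 ≤ y) :
    Real.exp (-1) * Real.exp (-y) ≤
      Real.sqrt y * ∫ t in Set.Ioi (0:ℝ), Real.exp (-y * Real.cosh t) := by
  have hy0 : 0 < y := by linarith
  have hs : 0 < Real.sqrt y := Real.sqrt_pos.2 hy0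
  have h1 : ∫ t in Set.Ioc (0:ℝ) (1 / Real.sqrt y), Real.exp (-y * Real.cosh t) ≤
      ∫ t in Set.Ioi (0:ℝ), Real.exp (-y * Real.cosh t) :=
    MeasureTheory.setIntegral_mono_set (integrable_exp_neg_mul_cosh hy0).integrableOn
      (Filter.Eventually.of_forall fun t => (Real.exp_pos _).le)
      (Filter.Eventually.of_forall fun t ht => ht.1)
  have h2 : ∫ t in Set.Ioc (0:ℝ) (1 / Real.sqrt y), Real.exp (-1) * Real.exp (-y) ≤
      ∫ t in Set.Ioc (0:ℝ) (1 / Real.sqrt y), Real.exp (-y * Real.cosh t) := by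
    refine MeasureTheory.setIntegral_mono_on
      (MeasureTheory.integrableOn_const (by simp))
      (integrable_exp_neg_mul_cosh hy0).integrableOn measurableSet_Ioc fun t ht => ?_
    rw [← Real.exp_add]
    apply Real.exp_le_exp.2
    have hsq : t ^ 2 * y ≤ 1 := by
      have := (le_div_iff₀ hs).1 ht.2
      have h3 : (t * Real.sqrt y) ^ 2 ≤ 1 := by
        have := mul_nonneg ht.1.le hs.le
        nlinarith
      rwa [mul_pow, Real.sq_sqrt hy0.le] at h3
    have ht1 : |t| ≤ 1 := by
      rw [← sq_le_one_iff_abs_le_one]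
      nlinarith [sq_nonneg t]
    nlinarith [cosh_sub_one_le_sq ht1]
  have h3 : ∫ t in Set.Ioc (0:ℝ) (1 / Real.sqrt y), Real.exp (-1) * Real.exp (-y) =
      (1 / Real.sqrt y) * (Real.exp (-1) * Real.exp (-y)) := by
    simp [MeasureTheory.integral_const, MeasureTheory.measureReal_def, Real.sqrt_nonneg]
  rw [h3] at h2
  calc _ = Real.sqrt y * ((1 / Real.sqrt y) * (Real.exp (-1) * Real.exp (-y))) := by
        field_simp
    _ ≤ _ := mul_le_mul_of_nonneg_left (h2.trans h1) hs.le

theorem exp_neg_mul_cosh_mul_sq_le {y : ℝ} (hy : 0 < y) (t : ℝ) :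
    Real.exp (-y * Real.cosh t) * t ^ 2 ≤
      4 / y * Real.exp (-y) * Real.exp (-(y / 4) * t ^ 2) := by
  have h1 : y / 4 * t ^ 2 * Real.exp (-(y / 4) * t ^ 2) ≤ 1 := by
    have h := Real.add_one_le_exp (y / 4 * t ^ 2)
    rw [neg_mul, Real.exp_neg, ← div_eq_mul_inv, div_le_one (Real.exp_pos _)]
    linarith
  have h2 := exp_neg_mul_cosh_le hy t
  have h3 : Real.exp (-(y / 2) * t ^ 2) =
      Real.exp (-(y / 4) * t ^ 2) * Real.exp (-(y / 4) * t ^ 2) := by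
    rw [← Real.exp_add]; ring_nf
  rw [h3] at h2
  have hp : 0 ≤ 4 / y * Real.exp (-y) * Real.exp (-(y / 4) * t ^ 2) := by positivity
  calc _ ≤ _ := mul_le_mul_of_nonneg_right h2 (sq_nonneg t)
    _ = 4 / y * Real.exp (-y) * Real.exp (-(y / 4) * t ^ 2) *
        (y / 4 * t ^ 2 * Real.exp (-(y / 4) * t ^ 2)) := by field_simp
    _ ≤ _ := mul_le_of_le_one_right hp h1

theorem le_WiR (R : ℝ) {y : ℝ} (hy : 1 ≤ y) :
    (Real.exp (-1) - R ^ 2 * Real.sqrt (π * 4) / y) * Real.exp (-y) ≤ WiR R y := by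
  have hy0 : 0 < y := by linarith
  have hi := (integrable_exp_neg_mul_cosh hy0).integrableOn (s := Set.Ioi (0:ℝ))
  have hg := ((integrable_exp_neg_mul_sq (b := y / 4) (by positivity)).const_mul
    (R ^ 2 / 2 * (4 / y * Real.exp (-y)))).integrableOn (s := Set.Ioi (0:ℝ))
  have h : ∫ t in Set.Ioi (0:ℝ), (Real.exp (-y * Real.cosh t) -
      R ^ 2 / 2 * (4 / y * Real.exp (-y)) * Real.exp (-(y / 4) * t ^ 2)) ≤
      ∫ t in Set.Ioi (0:ℝ), Real.exp (-y * Real.cosh t) * Real.cos (R * t) := by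
    refine MeasureTheory.integral_mono (hi.sub hg)
      (integrable_exp_neg_mul_cosh_mul_cos R hy0).integrableOn fun t => ?_
    have h1 := Real.one_sub_sq_div_two_le_cos (x := R * t)
    have h2 := mul_le_mul_of_nonneg_left (exp_neg_mul_cosh_mul_sq_le hy0 t)
      (by positivity : 0 ≤ R ^ 2 / 2)
    have h3 := mul_le_mul_of_nonneg_left h1 (Real.exp_pos (-y * Real.cosh t)).le
    simp only
    nlinarith
  rw [MeasureTheory.integral_sub hi hg, MeasureTheory.integral_const_mul,
    integral_gaussian_Ioi] at h
  have h4 := mul_le_mul_of_nonneg_left h (Real.sqrt_nonneg y)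
  have h5 := exp_neg_le_integral hy
  have h6 : Real.sqrt y * Real.sqrt (π / (y / 4)) = Real.sqrt (π * 4) := by
    rw [← Real.sqrt_mul hy0.le]
    congr 1
    field_simp
  have h7 : Real.sqrt y * (R ^ 2 / 2 * (4 / y * Real.exp (-y)) * (Real.sqrt (π / (y / 4)) / 2)) =
      R ^ 2 * Real.sqrt (π * 4) / y * Real.exp (-y) := by
    rw [← h6]; field_simp; norm_num
  rw [WiR]
  rw [mul_sub, h7] at h4
  linarith

theorem eventually_le_WiR (R : ℝ) :
    ∀ᶠ y : ℝ in Filter.atTop, Real.exp (-1) / 2 * Real.exp (-y) ≤ WiR R y := by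
  have h : Filter.Tendsto (fun y : ℝ => R ^ 2 * Real.sqrt (π * 4) / y) Filter.atTop (nhds 0) :=
    Filter.Tendsto.const_div_atTop Filter.tendsto_id _
  have hpos : 0 < Real.exp (-1) / 2 := by positivity
  filter_upwards [h.eventually (gt_mem_nhds hpos), Filter.eventually_ge_atTop 1] with y h1 h2
  refine le_trans (mul_le_mul_of_nonneg_right ?_ (Real.exp_pos _).le) (le_WiR R h2)
  linarith

theorem two_pi_mul_succ_pos (n : ℕ) {p : ℝ} (hp : 0 < p) : 0 < 2 * π * (n + 1) * p := by
  have := Real.pi_pos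
  positivity

theorem tendsto_two_pi_mul_succ {p : ℝ} (hp : 0 < p) :
    Filter.Tendsto (fun n : ℕ => 2 * π * (n + 1) * p) Filter.atTop Filter.atTop := by
  refine Filter.Tendsto.atTop_mul_const hp (Filter.Tendsto.const_mul_atTop Real.two_pi_pos ?_)
  exact Filter.tendsto_atTop_add_const_right _ _ tendsto_natCast_atTop_atTop

theorem summable_abs_mul_exp_of_summable (R c : ℝ) (b : ℕ → ℝ) {p q : ℝ} (hp : 0 < p)
    (hpq : p < q)
    (h : Summable fun n : ℕ =>
      b n * (WiR R (2 * π * (n + 1) * p) + c * WiR R (2 * π * (n + 1) * q))) :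
    Summable fun n : ℕ => |b n| * Real.exp (-(2 * π * (n + 1) * p)) := by
  have hexp : Filter.Tendsto (fun n : ℕ => |c| * (Real.sqrt (π * 2) / 2) *
      Real.exp (-(2 * π * (n + 1) * (q - p)))) Filter.atTop (nhds 0) := by
    have := (Real.tendsto_exp_neg_atTop_nhds_zero.comp
      (tendsto_two_pi_mul_succ (sub_pos.2 hpq))).const_mul (|c| * (Real.sqrt (π * 2) / 2))
    simpa using this
  have hpos : 0 < Real.exp (-1) / 4 := by positivity
  refine summable_of_isBigO_nat h.norm (Asymptotics.IsBigO.of_bound (4 / Real.exp (-1)) ?_)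
  filter_upwards [hexp.eventually (gt_mem_nhds hpos),
    (tendsto_two_pi_mul_succ hp).eventually (eventually_le_WiR R)] with n h1 h2
  set A := WiR R (2 * π * (n + 1) * p)
  set B := WiR R (2 * π * (n + 1) * q)
  set e := Real.exp (-(2 * π * (n + 1) * p)) with he
  have he0 : 0 < e := Real.exp_pos _
  have h3 : |c * B| ≤ Real.exp (-1) / 4 * e := by
    rw [abs_mul]
    calc _ ≤ |c| * (Real.sqrt (π * 2) / 2 * Real.exp (-(2 * π * (n + 1) * q))) :=
          mul_le_mul_of_nonneg_left
            (abs_WiR_le R (two_pi_mul_succ_pos n (hp.trans hpq))) (abs_nonneg c)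
      _ = |c| * (Real.sqrt (π * 2) / 2) * Real.exp (-(2 * π * (n + 1) * (q - p))) * e := by
          rw [he, mul_assoc _ (Real.exp _), ← Real.exp_add]
          ring_nf
      _ ≤ _ := mul_le_mul_of_nonneg_right h1.le he0.le
  have h4 : Real.exp (-1) / 4 * e ≤ |A + c * B| := by
    have := neg_abs_le (c * B)
    have := le_abs_self (A + c * B)
    linarith
  rw [norm_mul, norm_norm, norm_mul, Real.norm_eq_abs, Real.norm_eq_abs, Real.norm_eq_abs,
    Real.norm_eq_abs, abs_abs, abs_of_pos he0]
  calc |b n| * e = 4 / Real.exp (-1) * (|b n| * (Real.exp (-1) / 4 * e)) := by field_simp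
    _ ≤ _ := by gcongr

theorem norm_mul_WiR_le (R : ℝ) (b : ℝ) (n : ℕ) {p q : ℝ} (hp : 0 < p) (hpq : p ≤ q) :
    ‖b * WiR R (2 * π * (n + 1) * q)‖ ≤
      Real.sqrt (π * 2) / 2 * (|b| * Real.exp (-(2 * π * (n + 1) * p))) := by
  rw [norm_mul, Real.norm_eq_abs, Real.norm_eq_abs, mul_left_comm]
  refine mul_le_mul_of_nonneg_left
    ((abs_WiR_le R (two_pi_mul_succ_pos n (hp.trans_le hpq))).trans ?_) (abs_nonneg b)
  have := Real.pi_pos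
  gcongr

theorem summable_mul_WiR (R : ℝ) (b : ℕ → ℝ) {p q : ℝ} (hp : 0 < p) (hpq : p ≤ q)
    (h : Summable fun n : ℕ => |b n| * Real.exp (-(2 * π * (n + 1) * p))) :
    Summable fun n : ℕ => b n * WiR R (2 * π * (n + 1) * q) :=
  (h.mul_left (Real.sqrt (π * 2) / 2)).of_norm_bounded
    fun n => norm_mul_WiR_le R (b n) n hp hpq

theorem summable_abs_mul_exp_iff (R : ℝ) (b : ℕ → ℝ) {p : ℝ} (hp : 0 < p) :
    (Summable fun n : ℕ => |b n| * Real.exp (-(2 * π * (n + 1) * p))) ↔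
      Summable fun n : ℕ => b n * WiR R (2 * π * (n + 1) * p) := by
  refine ⟨summable_mul_WiR R b hp le_rfl, fun h => ?_⟩
  refine summable_abs_mul_exp_of_summable R 0 b hp (lt_add_one p) ?_
  simpa using h

theorem continuousAt_WiR_mul (R : ℝ) (n : ℕ) {p : ℝ} (hp : 0 < p) :
    ContinuousAt (fun q : ℝ => WiR R (2 * π * (n + 1) * q)) p :=
  ContinuousAt.comp (f := fun q : ℝ => 2 * π * (n + 1) * q)
    (continuousAt_WiR R (two_pi_mul_succ_pos n hp)) (by fun_prop)

theorem tendsto_tsum_mul_WiR (R : ℝ) (b : ℕ → ℝ) {p : ℝ} (hp : 0 < p)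
    (h : Summable fun n : ℕ => |b n| * Real.exp (-(2 * π * (n + 1) * p))) :
    Filter.Tendsto (fun q : ℝ => ∑' n : ℕ, b n * WiR R (2 * π * (n + 1) * q))
      (nhdsWithin p (Set.Ioi p)) (nhds (∑' n : ℕ, b n * WiR R (2 * π * (n + 1) * p))) := by
  refine tendsto_tsum_of_dominated_convergence (h.mul_left (Real.sqrt (π * 2) / 2))
    (fun n => ((continuousAt_WiR_mul R n hp).tendsto.mono_left nhdsWithin_le_nhds).const_mul _) ?_
  filter_upwards [self_mem_nhdsWithin] with q hq n
  exact norm_mul_WiR_le R (b n) n hp (le_of_lt hq)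

theorem hasDerivAt_tsum_WiR_mul_sin (R : ℝ) (b : ℕ → ℝ) {p : ℝ} (hp : 0 < p)
    (h : Summable fun n : ℕ => |b n| * Real.exp (-(2 * π * (n + 1) * p)))
    {u v : ℝ → ℝ} {u' : ℝ} (hu0 : u 0 = 0) (hu : HasDerivAt u u' 0) (hv : ContinuousAt v 0)
    (hpv : p < v 0) :
    HasDerivAt (fun x : ℝ => ∑' n : ℕ, b n / (n + 1) * WiR R (2 * π * (n + 1) * v x) *
        Real.sin (2 * π * (n + 1) * u x))
      (2 * π * u' * ∑' n : ℕ, b n * WiR R (2 * π * (n + 1) * v 0)) 0 := by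
  rw [hasDerivAt_iff_tendsto_slope]
  have hslope : (slope (fun x : ℝ => ∑' n : ℕ, b n / (n + 1) * WiR R (2 * π * (n + 1) * v x) *
        Real.sin (2 * π * (n + 1) * u x)) 0) = fun x => ∑' n : ℕ,
          b n / (n + 1) * WiR R (2 * π * (n + 1) * v x) *
            slope (fun x => Real.sin (2 * π * (n + 1) * u x)) 0 x := by
    funext x
    simp only [slope_def_field, hu0, mul_zero, Real.sin_zero, tsum_zero, sub_zero, mul_div_assoc']
    rw [tsum_div_const]
  rw [hslope, ← tsum_mul_left]
  have hu1 := (hasDerivAt_iff_tendsto_slope.1 hu).abs.eventually (gt_mem_nhds (lt_add_one |u'|))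
  refine tendsto_tsum_of_dominated_convergence
    (h.mul_left (2 * π * (|u'| + 1) * (Real.sqrt (π * 2) / 2))) (fun n => ?_) ?_
  · have hs : HasDerivAt (fun x => Real.sin (2 * π * (n + 1) * u x)) (2 * π * (n + 1) * u') 0 := by
      have := (hu.const_mul (2 * π * (n + 1))).sin
      simpa [hu0] using this
    have hW : ContinuousAt (fun x => WiR R (2 * π * (n + 1) * v x)) 0 :=
      ContinuousAt.comp (g := fun q : ℝ => WiR R (2 * π * (n + 1) * q))
        (continuousAt_WiR_mul R n (hp.trans hpv)) hv
    have := ((hW.tendsto.mono_left nhdsWithin_le_nhds).const_mul (b n / (n + 1))).mul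
      (hasDerivAt_iff_tendsto_slope.1 hs)
    convert this using 2
    field_simp
  · filter_upwards [hu1, (hv.eventually (lt_mem_nhds hpv)).filter_mono nhdsWithin_le_nhds]
      with x hx1 hx2 n
    have h1 : |slope (fun x => Real.sin (2 * π * (n + 1) * u x)) 0 x| ≤
        2 * π * (n + 1) * (|u'| + 1) := by
      have hk : 0 < 2 * π * ((n : ℝ) + 1) := by simpa using two_pi_mul_succ_pos n one_pos
      simp only [slope_def_field, hu0, mul_zero, Real.sin_zero, sub_zero] at hx1 ⊢
      rw [abs_div] at hx1 ⊢
      calc _ ≤ |2 * π * (n + 1) * u x| / |x| :=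
            div_le_div_of_nonneg_right Real.abs_sin_le_abs (abs_nonneg x)
        _ = 2 * π * (n + 1) * (|u x| / |x|) := by rw [abs_mul, abs_of_pos hk, mul_div_assoc]
        _ ≤ _ := mul_le_mul_of_nonneg_left hx1.le hk.le
    have h2 := norm_mul_WiR_le R (b n) n hp hx2.le
    have hn : (0:ℝ) < n + 1 := by positivity
    rw [norm_mul, Real.norm_eq_abs (slope _ _ _)]
    calc _ = ‖b n * WiR R (2 * π * (n + 1) * v x)‖ / (n + 1) *
          |slope (fun x => Real.sin (2 * π * (n + 1) * u x)) 0 x| := by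
          rw [div_mul_eq_mul_div, norm_div, Real.norm_of_nonneg hn.le]
      _ ≤ (Real.sqrt (π * 2) / 2 * (|b n| * Real.exp (-(2 * π * (n + 1) * p)))) / (n + 1) *
          (2 * π * (n + 1) * (|u'| + 1)) := by gcongr
      _ = _ := by field_simp

/-- Comparing `x`-derivatives at `z = iy` on both sides of the Fricke relation. -/
theorem tsum_eq_of_fricke {N : ℕ} (hN : 1 ≤ N) {R w : ℝ} {a : ℕ → ℝ} {f : ℂ → ℝ}
    (hf : ∀ z : ℂ, 0 < z.im →
      f z = ∑' n : ℕ, (a (n + 1) / Real.sqrt (n + 1)) *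
        WiR R (2 * π * (n + 1) * z.im) * Real.sin (2 * π * (n + 1) * z.re))
    (hfricke : ∀ z : ℂ, 0 < z.im → f z = w * f (-1 / (N * z)))
    (hderiv : ∀ y : ℝ, 0 < y →
      HasDerivAt (fun x : ℝ => f (x + y * Complex.I))
        (2 * π * ∑' n : ℕ, a (n + 1) * Real.sqrt (n + 1) * WiR R (2 * π * (n + 1) * y)) 0)
    {p y : ℝ} (hp : 0 < p) (hy : 0 < y) (hpy : p < 1 / (N * y))
    (h : Summable fun n : ℕ =>
      |a (n + 1) * Real.sqrt (n + 1)| * Real.exp (-(2 * π * (n + 1) * p))) :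
    ∑' n : ℕ, a (n + 1) * Real.sqrt (n + 1) * WiR R (2 * π * (n + 1) * y) =
      -(w / (N * y ^ 2)) * ∑' n : ℕ, a (n + 1) * Real.sqrt (n + 1) *
        WiR R (2 * π * (n + 1) * (1 / (N * y))) := by
  have hN0 : (0:ℝ) < N := by exact_mod_cast hN
  have hD (x : ℝ) : 0 < x ^ 2 + y ^ 2 := by positivity
  have hre (x : ℝ) : (-1 / (N * ((x : ℂ) + y * Complex.I))).re = -x / (N * (x ^ 2 + y ^ 2)) ∧
      (-1 / (N * ((x : ℂ) + y * Complex.I))).im = y / (N * (x ^ 2 + y ^ 2)) := by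
    have hne : ((x:ℂ) ^ 2 + (y:ℂ) ^ 2) ≠ 0 := by exact_mod_cast (hD x).ne'
    have hz : (x : ℂ) + y * Complex.I ≠ 0 := by
      intro h0
      have := congrArg Complex.im h0
      simp at this
      exact hy.ne' this
    have key : -1 / (N * ((x : ℂ) + y * Complex.I)) =
        ((-x / (N * (x ^ 2 + y ^ 2)) : ℝ) : ℂ) +
          ((y / (N * (x ^ 2 + y ^ 2)) : ℝ) : ℂ) * Complex.I := by
      have hNc : (N : ℂ) ≠ 0 := by exact_mod_cast hN0.ne'
      push_cast
      field_simp
      linear_combination (-(y:ℂ) ^ 2) * Complex.I_sq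
    rw [key]
    constructor <;> simp only [Complex.add_re, Complex.add_im, Complex.re_ofReal_mul,
      Complex.im_ofReal_mul, Complex.ofReal_re, Complex.ofReal_im, Complex.I_re, Complex.I_im] <;>
      ring
  have hv0 : y / (N * ((0:ℝ) ^ 2 + y ^ 2)) = 1 / (N * y) := by field_simp; simp
  have hu : HasDerivAt (fun x : ℝ => -x / (N * (x ^ 2 + y ^ 2))) (-1 / (N * y ^ 2)) 0 := by
    have hd : HasDerivAt (fun x : ℝ => (N : ℝ) * (x ^ 2 + y ^ 2)) 0 0 := by
      simpa using (((hasDerivAt_id (0:ℝ)).pow 2).add_const (y ^ 2)).const_mul (N : ℝ)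
    refine ((hasDerivAt_id (0:ℝ)).neg.div hd (mul_pos hN0 (hD 0)).ne').congr_deriv ?_
    rw [mul_zero, sub_zero, zero_pow two_ne_zero, zero_add]
    field_simp
  have hv : ContinuousAt (fun x : ℝ => y / (N * (x ^ 2 + y ^ 2))) 0 :=
    ContinuousAt.div continuousAt_const (by fun_prop) (mul_pos hN0 (hD 0)).ne'
  have hmain := (hasDerivAt_tsum_WiR_mul_sin R (fun n => a (n + 1) * Real.sqrt (n + 1)) hp h
    (by simp) hu hv (by rw [hv0]; exact hpy)).const_mul w
  have hfun : (fun x : ℝ => f (x + y * Complex.I)) = fun x : ℝ => w * ∑' n : ℕ,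
      a (n + 1) * Real.sqrt (n + 1) / (n + 1) *
        WiR R (2 * π * (n + 1) * (y / (N * (x ^ 2 + y ^ 2)))) *
        Real.sin (2 * π * (n + 1) * (-x / (N * (x ^ 2 + y ^ 2)))) := by
    funext x
    rw [hfricke _ (by simpa using hy), hf _ (by
      rw [(hre x).2]; exact div_pos hy (mul_pos hN0 (hD x))), (hre x).1, (hre x).2]
    congr 2
    funext n
    rw [mul_div_assoc (a (n + 1)), Real.sqrt_div_self', ← div_eq_mul_one_div]
  have huniq := (hderiv y hy).unique (hfun ▸ hmain)
  rw [hv0] at huniq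
  have hpi : 2 * π ≠ 0 := Real.two_pi_pos.ne'
  apply mul_left_cancel₀ hpi
  rw [huniq]
  ring

/-- At the fixed point of `y ↦ 1 / (N * y)` and sign `w = 1`, the derivative series vanishes. -/
theorem tsum_eq_zero_of_fricke {N : ℕ} (hN : 1 ≤ N) {R : ℝ} {a : ℕ → ℝ} {f : ℂ → ℝ}
    (hf : ∀ z : ℂ, 0 < z.im →
      f z = ∑' n : ℕ, (a (n + 1) / Real.sqrt (n + 1)) *
        WiR R (2 * π * (n + 1) * z.im) * Real.sin (2 * π * (n + 1) * z.re))
    (hfricke : ∀ z : ℂ, 0 < z.im → f z = 1 * f (-1 / (N * z)))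
    (hderiv : ∀ y : ℝ, 0 < y →
      HasDerivAt (fun x : ℝ => f (x + y * Complex.I))
        (2 * π * ∑' n : ℕ, a (n + 1) * Real.sqrt (n + 1) * WiR R (2 * π * (n + 1) * y)) 0)
    {y : ℝ} (hy : 0 < y) (hNy : N * y ^ 2 = 1) :
    ∑' n : ℕ, a (n + 1) * Real.sqrt (n + 1) * WiR R (2 * π * (n + 1) * y) = 0 := by
  have hN0 : (0:ℝ) < N := by exact_mod_cast hN
  have hyy : 1 / (N * y) = y := by
    rw [div_eq_iff (by positivity)]
    linarith
  by_cases hE : Summable fun n : ℕ =>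
      |a (n + 1) * Real.sqrt (n + 1)| * Real.exp (-(2 * π * (n + 1) * y))
  swap
  · rw [summable_abs_mul_exp_iff R (fun n : ℕ => a (n + 1) * Real.sqrt (n + 1)) hy] at hE
    exact tsum_eq_zero_of_not_summable hE
  by_cases hlow : ∃ p : ℝ, 0 < p ∧ p < y ∧ Summable fun n : ℕ =>
      |a (n + 1) * Real.sqrt (n + 1)| * Real.exp (-(2 * π * (n + 1) * p))
  · obtain ⟨p, hp, hpy, hs⟩ := hlow
    have h := tsum_eq_of_fricke hN hf hfricke hderiv hp hy (by rwa [hyy]) hs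
    rw [hyy, hNy] at h
    linarith
  push Not at hlow
  have hzero : ∀ v : ℝ, y < v →
      ∑' n : ℕ, a (n + 1) * Real.sqrt (n + 1) * WiR R (2 * π * (n + 1) * v) = 0 := by
    intro v hv
    have hv0 : 0 < v := hy.trans hv
    have hq : 0 < 1 / (N * v) := by positivity
    have hqv : 1 / (N * (1 / (N * v))) = v := by field_simp
    have hqy : 1 / (N * v) < y := by
      rw [← hyy]
      gcongr
    have hns := hlow _ hq hqy
    rw [summable_abs_mul_exp_iff R (fun n : ℕ => a (n + 1) * Real.sqrt (n + 1)) hq] at hns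
    have h := tsum_eq_of_fricke hN hf hfricke hderiv hy hq (by rwa [hqv]) hE
    rw [tsum_eq_zero_of_not_summable hns, hqv] at h
    have hne : -(1 / (N * (1 / (N * v)) ^ 2)) ≠ 0 := neg_ne_zero.2 (by positivity)
    exact (mul_eq_zero.1 h.symm).resolve_left hne
  refine tendsto_nhds_unique
    (tendsto_tsum_mul_WiR R (fun n : ℕ => a (n + 1) * Real.sqrt (n + 1)) hy hE) ?_
  refine tendsto_const_nhds.congr' ?_
  filter_upwards [self_mem_nhdsWithin] with v hv
  exact (hzero v hv).symm

theorem odd_fricke_relation (N : ℕ) (hN : 1 ≤ N) (R : ℝ) (w : ℝ) (hw : w = 1 ∨ w = -1)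
    (a : ℕ → ℝ) (f : ℂ → ℝ)
    (hf : ∀ z : ℂ, 0 < z.im →
      f z = ∑' n : ℕ, (a (n + 1) / Real.sqrt (n + 1)) *
        WiR R (2 * π * (n + 1) * z.im) * Real.sin (2 * π * (n + 1) * z.re))
    (hfricke : ∀ z : ℂ, 0 < z.im → f z = w * f (-1 / (N * z)))
    -- term-by-term differentiation in `x` of the Fourier expansion is valid
    (hderiv : ∀ y : ℝ, 0 < y →
      HasDerivAt (fun x : ℝ => f (x + y * Complex.I))
        (2 * π * ∑' n : ℕ, a (n + 1) * Real.sqrt (n + 1) * WiR R (2 * π * (n + 1) * y)) 0) :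
    (∀ y : ℝ, 0 < y →
      ∑' n : ℕ, a (n + 1) * Real.sqrt (n + 1) *
        (WiR R (2 * π * (n + 1) * y) + (w / (N * y ^ 2)) * WiR R (2 * π * (n + 1) / (N * y)))
        = 0) ∧
      (w = 1 → ∑' n : ℕ, a (n + 1) * Real.sqrt (n + 1) *
        WiR R (2 * π * (n + 1) / Real.sqrt N) = 0) := by
  have hN0 : (0:ℝ) < N := by exact_mod_cast hN
  have hw0 : w ≠ 0 := by rcases hw with rfl | rfl <;> norm_num
  have hww : w * w = 1 := by rcases hw with rfl | rfl <;> norm_num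
  refine ⟨fun y hy => ?_, fun h1 => ?_⟩
  · have harg (n : ℕ) : 2 * π * (n + 1) / (N * y) = 2 * π * (n + 1) * (1 / (N * y)) :=
      div_eq_mul_one_div _ _
    simp only [harg]
    have hq : 0 < 1 / (N * y) := by positivity
    have hqy : 1 / (N * (1 / (N * y))) = y := by field_simp
    have hc : w / (N * y ^ 2) ≠ 0 := div_ne_zero hw0 (by positivity)
    rcases eq_or_ne y (1 / (N * y)) with he | hne
    · have hNy : N * y ^ 2 = 1 := by
        rw [eq_div_iff (by positivity)] at he
        linarith
      rw [← he, hNy]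
      rcases hw with rfl | rfl
      · have h0 := tsum_eq_zero_of_fricke hN hf hfricke hderiv hy hNy
        simp only [div_one, one_mul, ← two_mul, mul_left_comm _ (2:ℝ)]
        rw [tsum_mul_left, h0, mul_zero]
      · simp
    by_cases hs : Summable fun n : ℕ => a (n + 1) * Real.sqrt (n + 1) *
        (WiR R (2 * π * (n + 1) * y) +
          (w / (N * y ^ 2)) * WiR R (2 * π * (n + 1) * (1 / (N * y))))
    swap
    · exact tsum_eq_zero_of_not_summable hs
    have key : ∃ p : ℝ, 0 < p ∧ p ≤ y ∧ p ≤ 1 / (N * y) ∧ (Summable fun n : ℕ =>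
          |a (n + 1) * Real.sqrt (n + 1)| * Real.exp (-(2 * π * (n + 1) * p))) ∧
        ∑' n : ℕ, a (n + 1) * Real.sqrt (n + 1) * WiR R (2 * π * (n + 1) * y) =
          -(w / (N * y ^ 2)) * ∑' n : ℕ, a (n + 1) * Real.sqrt (n + 1) *
            WiR R (2 * π * (n + 1) * (1 / (N * y))) := by
      rcases lt_or_gt_of_ne hne with hlt | hgt
      · have hE := summable_abs_mul_exp_of_summable R _
          (fun n : ℕ => a (n + 1) * Real.sqrt (n + 1)) hy hlt hs
        exact ⟨y, hy, le_rfl, hlt.le, hE,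
          tsum_eq_of_fricke hN hf hfricke hderiv hy hy hlt hE⟩
      · have hE := summable_abs_mul_exp_of_summable R (w / (N * y ^ 2))⁻¹
          (fun n : ℕ => a (n + 1) * Real.sqrt (n + 1)) hq hgt
          ((hs.mul_left (w / (N * y ^ 2))⁻¹).congr fun n => by
            rw [mul_left_comm, mul_add, inv_mul_cancel_left₀ hc,
              add_comm (WiR _ _)])
        have h := tsum_eq_of_fricke hN hf hfricke hderiv hq hq (by rwa [hqy]) hE
        refine ⟨1 / (N * y), hq, hgt.le, le_rfl, hE, ?_⟩
        rw [h, hqy]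
        have : -(w / (N * y ^ 2)) * -(w / (N * (1 / (N * y)) ^ 2)) = 1 := by
          field_simp
          linarith
        rw [← mul_assoc, this, one_mul]
    obtain ⟨p, hp, hpy, hpq, hE, h⟩ := key
    have hA := summable_mul_WiR R (fun n : ℕ => a (n + 1) * Real.sqrt (n + 1)) hp hpy hE
    have hB := summable_mul_WiR R (fun n : ℕ => a (n + 1) * Real.sqrt (n + 1)) hp hpq hE
    simp only [mul_add (a _ * _), mul_left_comm _ (w / (N * y ^ 2))]
    rw [hA.tsum_add (hB.mul_left _), tsum_mul_left, h]
    ring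
  · subst h1
    have hsN : 0 < 1 / Real.sqrt N := one_div_pos.2 (Real.sqrt_pos.2 hN0)
    have h0 := tsum_eq_zero_of_fricke hN hf hfricke hderiv hsN
      (by rw [div_pow, Real.sq_sqrt hN0.le]; field_simp)
    simpa only [mul_one_div] using h0
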